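/- On X = L²([0,∞), μ) with Gaussian measure dμ(x) = √(2/π) e^{-x²/2} dx, the right-translation semigroup T(t) is nonzero for every t ≥ 0: for each t there exists f ∈ X with T(t)f ≠ 0. Hence this semigroup is superstable but does not have finite time extinction. -/

import Mathlib

open Filter Topology MeasureTheory
open scoped ENNReal

/-- The Gaussian probability measure `√(2/π) e^{-x²/2} dx` on `[0,∞)`. -/
noncomputable def gaussMeasure : Measure ℝ :=
  (volume.restrict (Set.Ici (0 : ℝ))).withDensity
    (fun x => ENNReal.ofReal (Real.sqrt (2 / Real.pi) * Real.exp (-x ^ 2 / 2)))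

instance isFiniteMeasure_gaussMeasure : IsFiniteMeasure gaussMeasure := by
  have hint : Integrable (fun x : ℝ => Real.sqrt (2 / Real.pi) * Real.exp (-x ^ 2 / 2)) := by
    have h := (integrable_exp_neg_mul_sq (show (0 : ℝ) < 1 / 2 by norm_num)).const_mul
      (Real.sqrt (2 / Real.pi))
    refine h.congr (.of_forall fun x => ?_)
    ring_nf
  exact isFiniteMeasure_withDensity_ofReal hint.restrict.2

theorem gaussMeasure_ne_zero : gaussMeasure ≠ 0 := by
  intro h
  rw [gaussMeasure, withDensity_eq_zero_iff (by fun_prop)] at h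
  have hfalse : ∀ᵐ _ ∂(volume.restrict (Set.Ici (0 : ℝ))), False := by
    filter_upwards [h] with x hx
    have hpos : 0 < Real.sqrt (2 / Real.pi) * Real.exp (-x ^ 2 / 2) := by positivity
    exact (ENNReal.ofReal_pos.2 hpos).ne' hx
  have : (ae (volume.restrict (Set.Ici (0 : ℝ)))).NeBot := by
    rw [ae_neBot, Ne, Measure.restrict_eq_zero, Real.volume_Ici]
    exact ENNReal.top_ne_zero
  exact hfalse.exists.elim fun _ h => h

instance nontrivial_Lp_gaussMeasure : Nontrivial (Lp ℝ 2 gaussMeasure) := by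
  have : NeZero gaussMeasure := ⟨gaussMeasure_ne_zero⟩
  refine ⟨Lp.const 2 gaussMeasure (1 : ℝ), 0, fun h => ?_⟩
  have hnorm := Lp.norm_const (p := 2) (μ := gaussMeasure) (c := (1 : ℝ)) (by norm_num)
  have hpos : 0 < gaussMeasure.real Set.univ := measureReal_univ_pos
  rw [h, norm_zero, norm_one, one_mul] at hnorm
  exact (Real.rpow_pos_of_pos hpos _).ne hnorm

theorem lintegral_gaussMeasure {g : ℝ → ℝ≥0∞} (hg : Measurable g) :
    ∫⁻ s, g s ∂gaussMeasure = ∫⁻ s, (Set.Ici (0 : ℝ)).indicator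
      (fun s => ENNReal.ofReal (Real.sqrt (2 / Real.pi) * Real.exp (-s ^ 2 / 2)) * g s) s := by
  rw [gaussMeasure, lintegral_withDensity_eq_lintegral_mul _ (by fun_prop) hg,
    lintegral_indicator measurableSet_Ici]
  rfl

/-- Change of variables for the right translation: the Gaussian density at `u + t` is
`e^{-(ut + t²/2)}` times the density at `u`. -/
theorem lintegral_translation {g : ℝ → ℝ≥0∞} (hg : Measurable g) {t : ℝ} (ht : 0 ≤ t) :
    ∫⁻ s, (if t ≤ s then g (s - t) else 0) ∂gaussMeasure =
      ∫⁻ u, ENNReal.ofReal (Real.exp (-(u * t + t ^ 2 / 2))) * g u ∂gaussMeasure := by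
  rw [lintegral_gaussMeasure (Measurable.ite measurableSet_Ici (by fun_prop) measurable_const),
    lintegral_gaussMeasure (by fun_prop), ← lintegral_add_right_eq_self _ t]
  refine lintegral_congr fun u => ?_
  by_cases hu : 0 ≤ u
  · have hut : 0 ≤ u + t := by positivity
    have hexp : Real.exp (-(u + t) ^ 2 / 2) =
        Real.exp (-u ^ 2 / 2) * Real.exp (-(u * t + t ^ 2 / 2)) := by
      rw [← Real.exp_add]
      ring_nf
    simp only [Set.indicator, Set.mem_Ici, hu, hut, le_add_iff_nonneg_left, if_true,
      add_sub_cancel_right, hexp]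
    rw [← mul_assoc, ← mul_assoc, ENNReal.ofReal_mul (by positivity)]
  · simp [Set.indicator, hu]

theorem lintegral_enorm_sq_translation {f F : Lp ℝ 2 gaussMeasure} {t : ℝ} (ht : 0 ≤ t)
    (hF : (F : ℝ → ℝ) =ᵐ[gaussMeasure] fun s => if t ≤ s then f (s - t) else 0) :
    ∫⁻ s, ‖F s‖ₑ ^ 2 ∂gaussMeasure =
      ∫⁻ u, ENNReal.ofReal (Real.exp (-(u * t + t ^ 2 / 2))) * ‖f u‖ₑ ^ 2 ∂gaussMeasure := by
  have hf : Measurable f := (Lp.stronglyMeasurable f).measurable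
  rw [← lintegral_translation (hf.enorm.pow_const 2) ht]
  refine lintegral_congr_ae ?_
  filter_upwards [hF] with s hs
  rw [hs]
  split_ifs <;> simp

theorem eq_zero_of_translation_eq_zero {f F : Lp ℝ 2 gaussMeasure} {t : ℝ} (ht : 0 ≤ t)
    (hF : (F : ℝ → ℝ) =ᵐ[gaussMeasure] fun s => if t ≤ s then f (s - t) else 0)
    (h0 : F = 0) : f = 0 := by
  have hf : Measurable f := (Lp.stronglyMeasurable f).measurable
  have h := lintegral_enorm_sq_translation ht hF
  have hzero : ∫⁻ s, ‖F s‖ₑ ^ 2 ∂gaussMeasure = 0 := by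
    rw [lintegral_eq_zero_iff' (by fun_prop)]
    filter_upwards [(Lp.eq_zero_iff_ae_eq_zero).1 h0] with s hs
    simp [hs]
  rw [hzero, eq_comm, lintegral_eq_zero_iff (by fun_prop)] at h
  rw [Lp.eq_zero_iff_ae_eq_zero]
  filter_upwards [h] with u hu
  simpa [(Real.exp_pos _).not_ge, -neg_add_rev] using hu

theorem ae_nonneg_gaussMeasure : ∀ᵐ u ∂gaussMeasure, 0 ≤ u :=
  (withDensity_absolutelyContinuous _ _).ae_le (ae_restrict_mem measurableSet_Ici)

theorem ofReal_norm_sq_eq_lintegral {α : Type*} [MeasurableSpace α] {μ : Measure α}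
    (f : Lp ℝ 2 μ) : ENNReal.ofReal (‖f‖ ^ 2) = ∫⁻ s, ‖f s‖ₑ ^ 2 ∂μ := by
  rw [ENNReal.ofReal_pow (norm_nonneg _), ofReal_norm, Lp.enorm_def]
  simpa using eLpNorm_nnreal_pow_eq_lintegral (p := 2) (f := f) (μ := μ) (by norm_num)

theorem norm_translation_le {f F : Lp ℝ 2 gaussMeasure} {t : ℝ} (ht : 0 ≤ t)
    (hF : (F : ℝ → ℝ) =ᵐ[gaussMeasure] fun s => if t ≤ s then f (s - t) else 0) :
    ‖F‖ ≤ Real.exp (-(t ^ 2 / 4)) * ‖f‖ := by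
  have hle : ENNReal.ofReal (‖F‖ ^ 2) ≤
      ENNReal.ofReal (Real.exp (-(t ^ 2 / 2)) * ‖f‖ ^ 2) := by
    rw [ENNReal.ofReal_mul (Real.exp_nonneg _), ofReal_norm_sq_eq_lintegral,
      ofReal_norm_sq_eq_lintegral, lintegral_enorm_sq_translation ht hF,
      ← lintegral_const_mul' _ _ ENNReal.ofReal_ne_top]
    refine lintegral_mono_ae ?_
    filter_upwards [ae_nonneg_gaussMeasure] with u hu
    gcongr
    nlinarith [mul_nonneg hu ht]
  rw [ENNReal.ofReal_le_ofReal_iff (by positivity)] at hle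
  have hexp : Real.exp (-(t ^ 2 / 2)) = Real.exp (-(t ^ 2 / 4)) ^ 2 := by
    rw [← Real.exp_nat_mul]
    ring_nf
  rw [hexp, ← mul_pow] at hle
  exact (sq_le_sq₀ (norm_nonneg _) (by positivity)).1 hle

/-- The right-translation semigroup on `L²([0,∞), μ)` with Gaussian `μ` is
nonzero for every `t ≥ 0` (so it does not have finite time extinction), yet it
is superstable (`‖T(t)‖^{1/t} → 0`). -/
theorem gauss_translation_no_finite_time_extinction
    (T : ℝ → (Lp ℝ 2 gaussMeasure →L[ℝ] Lp ℝ 2 gaussMeasure))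
    (hT : ∀ t : ℝ, 0 ≤ t → ∀ f : Lp ℝ 2 gaussMeasure,
      (T t f : ℝ → ℝ) =ᵐ[gaussMeasure] fun s => if t ≤ s then f (s - t) else 0) :
    (∀ t : ℝ, 0 ≤ t → ∃ f : Lp ℝ 2 gaussMeasure, T t f ≠ 0) ∧
    (¬ ∃ t : ℝ, 0 ≤ t ∧ T t = 0) ∧
    Filter.Tendsto (fun t : ℝ => ‖T t‖ ^ (1 / t)) Filter.atTop (𝓝 0) := by
  have hinj : ∀ t : ℝ, 0 ≤ t → ∃ f : Lp ℝ 2 gaussMeasure, T t f ≠ 0 := by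
    intro t ht
    obtain ⟨f, hf⟩ := exists_ne (0 : Lp ℝ 2 gaussMeasure)
    exact ⟨f, fun h => hf (eq_zero_of_translation_eq_zero ht (hT t ht f) h)⟩
  refine ⟨hinj, ?_, ?_⟩
  · rintro ⟨t, ht, h0⟩
    obtain ⟨f, hf⟩ := hinj t ht
    exact hf (by simp [h0])
  · have hbound : ∀ᶠ t : ℝ in atTop, ‖T t‖ ^ (1 / t) ≤ Real.exp (-(t / 4)) := by
      filter_upwards [eventually_gt_atTop 0] with t ht
      have hnorm : ‖T t‖ ≤ Real.exp (-(t ^ 2 / 4)) :=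
        (T t).opNorm_le_bound (Real.exp_nonneg _) fun f =>
          norm_translation_le ht.le (hT t ht.le f)
      calc ‖T t‖ ^ (1 / t) ≤ Real.exp (-(t ^ 2 / 4)) ^ (1 / t) :=
            Real.rpow_le_rpow (norm_nonneg _) hnorm (by positivity)
        _ = Real.exp (-(t / 4)) := by
            rw [← Real.exp_mul]
            congr 1
            field_simp
    refine squeeze_zero' (.of_forall fun t => Real.rpow_nonneg (norm_nonneg _) _) hbound ?_
    exact Real.tendsto_exp_neg_atTop_nhds_zero.comp (tendsto_id.atTop_div_const (by norm_num))
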